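/- Let S be a compact, orientable, two-dimensional embedded C^∞ submanifold of ℝ³ without boundary. There exist constants c > 0 and h₀ > 0, depending only on S and γ₀ (in particular independent of z₀ and h), such that for every z₀ ∈ S and every admissible quasi-uniform triangulation T_h with h ≤ h₀ the following holds. Let Ω ⊂ S_h be the union of all triangles τ ∈ T_h with inf_{x ∈ τ} r(x) ≥ h. Then for every φ ∈ V_h and every v ∈ V_h that equals r²φ at all vertices of triangles contained in Ω, ∫_Ω r^{-2} |∇_{S_h}( r² φ − v )|² ≤ c ∫_Ω φ². -/

import Mathlib

open MeasureTheory Metric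
open scoped RealInnerProductSpace ENNReal NNReal

noncomputable section

/-- Ambient Euclidean space `ℝ³`. -/
abbrev E3 : Type := EuclideanSpace ℝ (Fin 3)

/-- The tangential gradient of `w : E3 → ℝ` along the set `A` at `x`, with values projected
onto the subspace `P`: the orthogonal projection onto `P` of the Riesz representative of the
derivative of `w` within `A` at `x`. -/
def tGrad (A : Set E3) (P : Submodule ℝ E3) (w : E3 → ℝ) (x : E3) : E3 :=
  (Submodule.orthogonalProjectionOnto P ((InnerProductSpace.toDual ℝ E3).symm (fderivWithin ℝ w A x)) : E3)

/-- A compact, orientable, two-dimensional embedded `C^∞` submanifold of `ℝ³` without boundary,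
described by a global smooth unit normal field `n` and local smooth regular defining functions. -/
structure SmoothSurface where
  S : Set E3
  n : E3 → E3
  compact : IsCompact S
  nonempty : S.Nonempty
  localLevel : ∀ x ∈ S, ∃ U : Set E3, ∃ F : E3 → ℝ, IsOpen U ∧ x ∈ U ∧
    ContDiff ℝ (⊤ : ℕ∞) F ∧ S ∩ U = {y ∈ U | F y = 0} ∧
    (∀ y ∈ U, gradient F y ≠ 0) ∧
    (∀ y, y ∈ S ∩ U → ∃ t : ℝ, gradient F y = t • n y)
  n_unit : ∀ x ∈ S, ‖n x‖ = 1
  n_smooth : ∃ U : Set E3, IsOpen U ∧ S ⊆ U ∧ ContDiffOn ℝ (⊤ : ℕ∞) n U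

namespace SmoothSurface

variable (Srf : SmoothSurface)

/-- The tangent plane of `S` at `x`, as the orthogonal complement of the normal. -/
def tangent (x : E3) : Submodule ℝ E3 := (ℝ ∙ Srf.n x)ᗮ

/-- The tangential gradient `∇_S w` on the surface. -/
def grad (w : E3 → ℝ) (x : E3) : E3 := tGrad Srf.S (Srf.tangent x) w x

/-- The bilinear form `a(v,w) = ∫_S (⟨∇_S v, ∇_S w⟩ + v w)` (w.r.t. 2-dimensional
Hausdorff measure on `S`). -/
def aForm (v w : E3 → ℝ) : ℝ :=
  ∫ x in Srf.S, (⟪Srf.grad v x, Srf.grad w x⟫ + v x * w x) ∂μH[2]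

end SmoothSurface

/-- The (closed, flat) triangle with vertices `t.1, t.2.1, t.2.2`. -/
def triOf (t : E3 × E3 × E3) : Set E3 := convexHull ℝ {t.1, t.2.1, t.2.2}

/-- The vertex set of a triangle. -/
def vertsOf (t : E3 × E3 × E3) : Set E3 := {t.1, t.2.1, t.2.2}

/-- The plane spanned by a triangle. -/
def planeOf (t : E3 × E3 × E3) : Set E3 := (affineSpan ℝ (vertsOf t) : Set E3)

/-- The direction (2-dimensional linear subspace) of the plane of a triangle. -/
def dirOf (t : E3 × E3 × E3) : Submodule ℝ E3 := (affineSpan ℝ (vertsOf t)).direction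

/-- The triangle-wise tangential gradient `∇_{S_h} w` on the triangle `t`. -/
def gradTri (t : E3 × E3 × E3) (w : E3 → ℝ) (x : E3) : E3 := tGrad (triOf t) (dirOf t) w x

/-- An admissible quasi-uniform triangulation `T_h` of the surface `Srf` with mesh parameter `h`
and quasi-uniformity constant `γ₀`, together with the nearest-point projection `a` defined on
a tubular neighbourhood `N` of the surface. -/
structure Triangulation (Srf : SmoothSurface) (γ₀ h : ℝ) where
  T : Finset (E3 × E3 × E3)
  a : E3 → E3
  N : Set E3
  T_nonempty : T.Nonempty
  indep : ∀ t ∈ T, AffineIndependent ℝ ![t.1, t.2.1, t.2.2]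
  verts_on : ∀ t ∈ T, vertsOf t ⊆ Srf.S
  meet : ∀ t ∈ T, ∀ t' ∈ T, t ≠ t' →
    triOf t ∩ triOf t' = ∅ ∨
    (∃ v, v ∈ vertsOf t ∩ vertsOf t' ∧ triOf t ∩ triOf t' = {v}) ∨
    (∃ v w, v ≠ w ∧ v ∈ vertsOf t ∩ vertsOf t' ∧ w ∈ vertsOf t ∩ vertsOf t' ∧
      triOf t ∩ triOf t' = segment ℝ v w)
  diam_le : ∀ t ∈ T, Metric.diam (triOf t) ≤ h
  disk : ∀ t ∈ T, ∃ y ∈ triOf t, closedBall y (γ₀ * h) ∩ planeOf t ⊆ triOf t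
  N_open : IsOpen N
  S_sub : Srf.S ⊆ N
  Sh_sub : (⋃ t ∈ T, triOf t) ⊆ N
  a_smooth : ContDiffOn ℝ (⊤ : ℕ∞) a N
  a_mem : ∀ x ∈ N, a x ∈ Srf.S
  a_nearest : ∀ x ∈ N, ∀ y ∈ Srf.S, dist x (a x) ≤ dist x y
  a_unique : ∀ x ∈ N, ∀ y ∈ Srf.S, dist x y = dist x (a x) → y = a x
  a_bij : Set.BijOn a (⋃ t ∈ T, triOf t) Srf.S

namespace Triangulation

variable {Srf : SmoothSurface} {γ₀ h : ℝ} (Tr : Triangulation Srf γ₀ h)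

/-- The polyhedral surface `S_h`, the union of the triangles. -/
def Sh : Set E3 := ⋃ t ∈ Tr.T, triOf t

/-- Membership in the finite element space `V_h` of continuous, piecewise affine functions
on `S_h` (as functions `E3 → ℝ`; only the values on `S_h` are relevant). -/
def IsVh (v : E3 → ℝ) : Prop :=
  ContinuousOn v Tr.Sh ∧
  ∀ t ∈ Tr.T, ∃ (L : E3 →ₗ[ℝ] ℝ) (c : ℝ), ∀ x ∈ triOf t, v x = L x + c


/-- The discrete bilinear form
`a_h(v,w) = ∫_{S_h} (⟨∇_{S_h} v, ∇_{S_h} w⟩ + v w)`, computed triangle by triangle. -/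
def ahForm (v w : E3 → ℝ) : ℝ :=
  ∑ t ∈ Tr.T, ∫ x in triOf t,
    (⟪gradTri t v x, gradTri t w x⟫ + v x * w x) ∂μH[2]

/-- The lift of a function on `S_h` to a function on `S` via the inverse of `a|_{S_h}`. -/
def liftS (w : E3 → ℝ) : E3 → ℝ := fun y => w (Function.invFunOn Tr.a Tr.Sh y)

/-- The lift of `f : S → ℝ` to `S_h` is `f ∘ a`. -/
def liftSh (f : E3 → ℝ) : E3 → ℝ := fun x => f (Tr.a x)

end Triangulation

/-- `f` is smooth in a neighbourhood of the set `A`. -/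
def SmoothNear (f : E3 → ℝ) (A : Set E3) : Prop :=
  ∃ V : Set E3, IsOpen V ∧ A ⊆ V ∧ ContDiffOn ℝ (⊤ : ℕ∞) f V

/-- `u` is the (weak, hence smooth) solution of `-Δ_S u + u = f` on the surface `Srf`. -/
def IsSolution (Srf : SmoothSurface) (f u : E3 → ℝ) : Prop :=
  SmoothNear u Srf.S ∧
  ∀ φ : E3 → ℝ, ContDiff ℝ (⊤ : ℕ∞) φ → Srf.aForm u φ = ∫ x in Srf.S, f x * φ x ∂μH[2]

/-- `uh` is the discrete Galerkin solution in `V_h` with data the lift `f ∘ a` of `f`. -/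
def Triangulation.IsDiscreteSolution {Srf : SmoothSurface} {γ₀ h : ℝ}
    (Tr : Triangulation Srf γ₀ h) (f uh : E3 → ℝ) : Prop :=
  Tr.IsVh uh ∧
  ∀ φh : E3 → ℝ, Tr.IsVh φh →
    Tr.ahForm uh φh = ∫ x in Tr.Sh, f (Tr.a x) * φh x ∂μH[2]

/-- Orthogonal projection onto the affine tangent plane of `S` at `z₀`. -/
def SmoothSurface.P0 (Srf : SmoothSurface) (z₀ : E3) (x : E3) : E3 :=
  z₀ + (Submodule.orthogonalProjectionOnto (Srf.tangent z₀) (x - z₀) : E3)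

/-- `r(x) = ‖P₀(x) − z₀‖`, the distance of the tangential projection of `x` to `z₀`. -/
def SmoothSurface.rfn (Srf : SmoothSurface) (z₀ : E3) (x : E3) : ℝ :=
  ‖Srf.P0 z₀ x - z₀‖

/-- The affine tangent plane `z₀ + T_{z₀}S`. -/
def SmoothSurface.tplane (Srf : SmoothSurface) (z₀ : E3) : Set E3 :=
  {x : E3 | x - z₀ ∈ Srf.tangent z₀}

/-- The disk `D = B₁₀₀(z₀)` in the affine tangent plane at `z₀`. -/
def SmoothSurface.disk100 (Srf : SmoothSurface) (z₀ : E3) : Set E3 :=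
  Srf.tplane z₀ ∩ closedBall z₀ 100

/-- `r₁ > 0` is a graph radius for `S`: uniformly in `z₀ ∈ S`, the piece `B_{2r₁}(z₀) ∩ S`
is a graph over the tangent plane at `z₀`, in particular `P₀` is injective on it. -/
def SmoothSurface.IsGraphRadius (Srf : SmoothSurface) (r₁ : ℝ) : Prop :=
  0 < r₁ ∧ r₁ ≤ 1 ∧ ∀ z₀ ∈ Srf.S, Set.InjOn (Srf.P0 z₀) (Srf.S ∩ closedBall z₀ (2 * r₁))

/-- `ζ` is an admissible smooth cutoff at `z₀`: supported in the ball of radius `3r₁/2`,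
equal to `1` on the ball of radius `r₁`, with `C²`-bounds at most `Cζ` (uniform in `z₀`). -/
def IsCutoff (z₀ : E3) (r₁ Cζ : ℝ) (ζ : E3 → ℝ) : Prop :=
  ContDiff ℝ (⊤ : ℕ∞) ζ ∧ tsupport ζ ⊆ closedBall z₀ (3 / 2 * r₁) ∧
  (∀ x ∈ closedBall z₀ r₁, ζ x = 1) ∧
  ∀ x : E3, |ζ x| + ‖fderiv ℝ ζ x‖ + ‖fderiv ℝ (fderiv ℝ ζ) x‖ ≤ Cζ

/-- `v` is the Neumann Green's function with pole `z₀` of `−Δ + 1` on the disk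
`D = B₁₀₀(z₀)` in the tangent plane at `z₀`: it is smooth away from the pole, satisfies
`∫_D (⟨∇v, ∇φ⟩ + v φ) = φ(z₀)` for every smooth test function, and differs from
`(1/2π) log‖· − z₀‖` by an `H²(D)`-function with norm at most `CG`. -/
def SmoothSurface.IsGreen (Srf : SmoothSurface) (z₀ : E3) (CG : ℝ) (v : E3 → ℝ) : Prop :=
  ContDiffOn ℝ (⊤ : ℕ∞) v (Srf.disk100 z₀ \ {z₀}) ∧
  (∀ φ : E3 → ℝ, ContDiff ℝ (⊤ : ℕ∞) φ →
    ∫ x in Srf.disk100 z₀,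
      (⟪tGrad (Srf.disk100 z₀) (Srf.tangent z₀) v x,
        tGrad (Srf.disk100 z₀) (Srf.tangent z₀) φ x⟫ + v x * φ x) ∂μH[2] = φ z₀) ∧
  (∫ x in Srf.disk100 z₀,
      ((v x - (1 / (2 * Real.pi)) * Real.log ‖x - z₀‖) ^ 2 +
        ‖fderivWithin ℝ (fun y => v y - (1 / (2 * Real.pi)) * Real.log ‖y - z₀‖)
            (Srf.disk100 z₀) x‖ ^ 2 +
        ‖fderivWithin ℝ
            (fun y => fderivWithin ℝ
              (fun y' => v y' - (1 / (2 * Real.pi)) * Real.log ‖y' - z₀‖)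
              (Srf.disk100 z₀) y)
            (Srf.disk100 z₀) x‖ ^ 2) ∂μH[2]) ≤ CG

/-- The approximate Green's function `g̃(x) = ζ(x) v(P₀(x))` on `S`. -/
def approxGreen (Srf : SmoothSurface) (z₀ : E3) (ζ v : E3 → ℝ) : E3 → ℝ :=
  fun x => ζ x * v (Srf.P0 z₀ x)

/-- The cut-off lifted logarithm `l̃(x) = ζ(x) log r(x)` on `S`. -/
def cutLog (Srf : SmoothSurface) (z₀ : E3) (ζ : E3 → ℝ) : E3 → ℝ :=
  fun x => ζ x * Real.log (Srf.rfn z₀ x)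

/-- `lh` is the discrete (Galerkin) projection of the function `w` on `S`:
`a_h(lh, v_h) = a(w, V_h)` for all `v_h ∈ V_h`, where `V_h` is the lift of `v_h` to `S`. -/
def Triangulation.IsDiscreteProjection {Srf : SmoothSurface} {γ₀ h : ℝ}
    (Tr : Triangulation Srf γ₀ h) (w lh : E3 → ℝ) : Prop :=
  Tr.IsVh lh ∧ ∀ vh : E3 → ℝ, Tr.IsVh vh → Tr.ahForm lh vh = Srf.aForm w (Tr.liftS vh)


lemma triOf_convex (t : E3 × E3 × E3) : Convex ℝ (triOf t) := convex_convexHull ℝ _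

lemma verts_sub_tri (t : E3 × E3 × E3) : vertsOf t ⊆ triOf t := subset_convexHull ℝ _

lemma triOf_compact (t : E3 × E3 × E3) : IsCompact (triOf t) :=
  Set.Finite.isCompact_convexHull ℝ (by simp)

lemma tri_measure_lt_top (t : E3 × E3 × E3) : (μH[2] : Measure E3) (triOf t) < ⊤ := by
  let A : (Fin 2 → ℝ) →ₗ[ℝ] E3 :=
    (LinearMap.proj 0).smulRight (t.2.1 - t.1) + (LinearMap.proj 1).smulRight (t.2.2 - t.1)
  let B : (Fin 2 → ℝ) →L[ℝ] E3 := LinearMap.toContinuousLinearMap A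
  have hB : ∀ u, B u = u 0 • (t.2.1 - t.1) + u 1 • (t.2.2 - t.1) := fun u => rfl
  have hlip : LipschitzWith ‖B‖₊ (fun u => t.1 + B u) := by
    refine LipschitzWith.of_dist_le_mul fun x y => ?_
    rw [dist_add_left]
    exact B.lipschitz.dist_le_mul x y
  have hsub : triOf t ⊆ (fun u => t.1 + B u) '' (Set.Icc 0 1) := by
    refine convexHull_min ?_ ?_
    · have h01 : (0 : Fin 2 → ℝ) ≤ 1 := zero_le_one
      rintro x (rfl | rfl | rfl)
      · exact ⟨0, ⟨le_rfl, h01⟩, by simp⟩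
      · refine ⟨![1, 0], ⟨?_, ?_⟩, by simp [hB]⟩ <;> intro i <;> fin_cases i <;> simp
      · refine ⟨![0, 1], ⟨?_, ?_⟩, by simp [hB]⟩ <;> intro i <;> fin_cases i <;> simp
    · have h1 : Convex ℝ (B '' Set.Icc 0 1) := (convex_Icc _ _).linear_image B.toLinearMap
      have h2 := h1.translate t.1
      rwa [Set.image_image] at h2
  have h1 := hlip.hausdorffMeasure_image_le (d := 2) (by norm_num) (Set.Icc 0 1)
  refine (measure_mono hsub).trans_lt (h1.trans_lt ?_)
  have h2 : (μH[2] : Measure (Fin 2 → ℝ)) = volume := by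
    have := hausdorffMeasure_pi_real (ι := Fin 2)
    simpa using this
  rw [h2]
  refine ENNReal.mul_lt_top ?_ ?_
  · exact ENNReal.rpow_lt_top_of_nonneg (by norm_num) ENNReal.coe_ne_top
  · exact (isCompact_Icc).measure_lt_top

lemma segment_null (v w : E3) : (μH[2] : Measure E3) (segment ℝ v w) = 0 := by
  rcases Measure.hausdorffMeasure_zero_or_top (X := E3) (show (1 : ℝ) < 2 by norm_num)
    (segment ℝ v w) with h | h
  · exact h
  · rw [hausdorffMeasure_segment] at h
    exact absurd h (edist_ne_top _ _)

lemma affine_abs_le (t : E3 × E3 × E3) (L : E3 →ₗ[ℝ] ℝ) (c M : ℝ)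
    (h : ∀ p ∈ vertsOf t, |L p + c| ≤ M) : ∀ x ∈ triOf t, |L x + c| ≤ M := by
  have hc : Convex ℝ {x : E3 | |L x + c| ≤ M} := by
    intro x hx y hy a b ha hb hab
    simp only [Set.mem_ofPred_eq, abs_le] at *
    have e : L (a • x + b • y) + c = a * (L x + c) + b * (L y + c) := by
      simp only [map_add, map_smul, smul_eq_mul]
      linear_combination (-c) * hab
    rw [e]
    constructor
    · nlinarith [mul_le_mul_of_nonneg_left hx.1 ha, mul_le_mul_of_nonneg_left hy.1 hb]
    · nlinarith [mul_le_mul_of_nonneg_left hx.2 ha, mul_le_mul_of_nonneg_left hy.2 hb]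
  exact convexHull_min h hc

lemma exists_max_vertex (t : E3 × E3 × E3) (f : E3 → ℝ) :
    ∃ p ∈ vertsOf t, ∀ q ∈ vertsOf t, f q ≤ f p := by
  have hf : (vertsOf t).Finite := by unfold vertsOf; simp
  exact Set.exists_max_image _ f hf ⟨t.1, by simp [vertsOf]⟩

/-- Lower bound for the mass of an affine function on a triangle. -/
lemma mass_lower (t : E3 × E3 × E3) (φ : E3 → ℝ) (L : E3 →ₗ[ℝ] ℝ) (c : ℝ)
    (hφ : ∀ x ∈ triOf t, φ x = L x + c) (p : E3) (hp : p ∈ vertsOf t)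
    (hmax : ∀ x ∈ triOf t, |φ x| ≤ |φ p|) :
    |φ p| ^ 2 * (μH[2] : Measure E3).real (triOf t) ≤ 64 * ∫ x in triOf t, φ x ^ 2 ∂μH[2] := by
  set μ : Measure E3 := μH[2]
  have hpt := verts_sub_tri t hp
  let H : E3 →ᵃ[ℝ] E3 := AffineMap.homothety p (1/4 : ℝ)
  have hH : ∀ x, H x = (1/4 : ℝ) • (x - p) + p := fun x => by
    simp [H, AffineMap.homothety_apply]
  let t' : Set E3 := H '' triOf t
  have hsub : t' ⊆ triOf t := by
    rintro _ ⟨x, hx, rfl⟩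
    have : H x = (1/4 : ℝ) • x + (3/4 : ℝ) • p := by rw [hH]; module
    rw [this]
    exact triOf_convex t hx hpt (by norm_num) (by norm_num) (by norm_num)
  have hHc : Continuous H := by
    have : (H : E3 → E3) = fun x => (1/4 : ℝ) • (x - p) + p := funext hH
    rw [this]; fun_prop
  have hcomp' : IsCompact t' := (triOf_compact t).image hHc
  have hLc : Continuous L := L.continuous_of_finiteDimensional
  have hcont : ContinuousOn (fun x => φ x ^ 2) (triOf t) := by
    refine ContinuousOn.congr (f := fun x => (L x + c) ^ 2) (by fun_prop) ?_
    intro x hx; simp only [hφ x hx]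
  have hintg : IntegrableOn (fun x => φ x ^ 2) (triOf t) μ := by
    refine IntegrableOn.of_bound (tri_measure_lt_top t)
      (hcont.aestronglyMeasurable (triOf_compact t).measurableSet) (|φ p| ^ 2) ?_
    refine ae_restrict_of_forall_mem (triOf_compact t).measurableSet fun x hx => ?_
    rw [Real.norm_eq_abs, abs_pow]
    exact pow_le_pow_left₀ (abs_nonneg _) (hmax x hx) 2
  have hlow : ∀ x ∈ t', |φ p| ^ 2 / 4 ≤ φ x ^ 2 := by
    rintro _ ⟨x, hx, rfl⟩
    have h1 : φ (H x) = φ x / 4 + 3 / 4 * φ p := by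
      rw [hφ _ (hsub ⟨x, hx, rfl⟩), hφ x hx, hφ p hpt, hH]
      simp only [map_add, map_smul, map_sub, smul_eq_mul]; ring
    have h2 := hmax x hx
    have h3 : |φ p| / 2 ≤ |φ (H x)| := by
      rw [h1]
      have := abs_sub_abs_le_abs_sub (3 / 4 * φ p) (-(φ x / 4))
      rw [abs_neg, abs_div, abs_mul] at this
      norm_num at this
      rw [add_comm]
      linarith
    rw [← sq_abs (φ (H x))]
    have := pow_le_pow_left₀ (by positivity) h3 2
    linarith [this, (by ring : (|φ p| / 2) ^ 2 = |φ p| ^ 2 / 4)]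
  have hm' : μ.real t' = μ.real (triOf t) / 16 := by
    have := hausdorffMeasure_homothety_image (𝕜 := ℝ) (d := 2) (by norm_num) p
      (c := (1/4 : ℝ)) (by norm_num) (triOf t)
    have h2 : μ t' = ‖(1/4 : ℝ)‖₊ ^ (2:ℝ) • μ (triOf t) := this
    rw [Measure.real, h2, ENNReal.smul_def, smul_eq_mul, ENNReal.toReal_mul, Measure.real]
    simp
    norm_num
    ring
  have hne : μ t' ≠ ⊤ := ((measure_mono hsub).trans_lt (tri_measure_lt_top t)).ne
  have h1 := setIntegral_ge_of_const_le_real hcomp'.measurableSet hne hlow (hintg.mono_set hsub)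
  have h2 : ∫ x in t', φ x ^ 2 ∂μ ≤ ∫ x in triOf t, φ x ^ 2 ∂μ :=
    setIntegral_mono_set hintg (Filter.Eventually.of_forall fun x => sq_nonneg _)
      hsub.eventuallyLE
  rw [hm'] at h1
  linarith

/-- Pointwise gradient bound. -/
lemma grad_bound (Srf : SmoothSurface) {γ₀ h : ℝ} (hγ₀ : 0 < γ₀) (hh : 0 < h) (z₀ : E3)
    (t : E3 × E3 × E3) (hdiam : Metric.diam (triOf t) ≤ h)
    (hdisk : ∃ y ∈ triOf t, closedBall y (γ₀ * h) ∩ planeOf t ⊆ triOf t)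
    (φ v : E3 → ℝ) (L : E3 →ₗ[ℝ] ℝ) (c : ℝ) (hφ : ∀ x ∈ triOf t, φ x = L x + c)
    (L' : E3 →ₗ[ℝ] ℝ) (c' : ℝ) (hv : ∀ x ∈ triOf t, v x = L' x + c')
    (hr : ∀ x ∈ triOf t, h ≤ Srf.rfn z₀ x)
    (hvert : ∀ p ∈ vertsOf t, v p = Srf.rfn z₀ p ^ 2 * φ p)
    (M : ℝ) (hM : ∀ x ∈ triOf t, |φ x| ≤ M) (x : E3) (hx : x ∈ triOf t) :
    ‖gradTri t (fun y => Srf.rfn z₀ y ^ 2 * φ y - v y) x‖ ≤ 5 * M / γ₀ * Srf.rfn z₀ x := by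
  have hM0 : 0 ≤ M := (abs_nonneg _).trans (hM x hx)
  let A : E3 →L[ℝ] Srf.tangent z₀ := Submodule.orthogonalProjectionOnto (Srf.tangent z₀)
  have hA : ∀ d, ‖A d‖ ≤ ‖d‖ := fun d => Submodule.norm_orthogonalProjectionOnto_apply_le _ d
  have hrfn : ∀ y, Srf.rfn z₀ y = ‖A (y - z₀)‖ := fun y => by
    simp [SmoothSurface.rfn, SmoothSurface.P0, A]
  let Lc : E3 →L[ℝ] ℝ := LinearMap.toContinuousLinearMap L
  let Lc' : E3 →L[ℝ] ℝ := LinearMap.toContinuousLinearMap L'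
  let W : E3 → ℝ := fun y => ‖A (y - z₀)‖ ^ 2 * (Lc y + c) - (Lc' y + c')
  let w : E3 → ℝ := fun y => Srf.rfn z₀ y ^ 2 * φ y - v y
  have hwW : ∀ y ∈ triOf t, w y = W y := fun y hy => by
    simp only [w, W, hrfn, hφ y hy, hv y hy]; rfl
  have hAd : HasFDerivAt (fun y => A (y - z₀)) A x := by
    have := A.hasFDerivAt.comp x ((hasFDerivAt_id x).sub_const z₀)
    rw [ContinuousLinearMap.comp_id] at this
    exact this
  have hWd := ((hAd.norm_sq).mul (Lc.hasFDerivAt.add_const c)).sub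
    (Lc'.hasFDerivAt.add_const c')
  have hwd : HasFDerivWithinAt w _ (triOf t) x :=
    (hWd.hasFDerivWithinAt (s := triOf t)).congr (fun y hy => hwW y hy) (hwW x hx)
  set D := fderivWithin ℝ w (triOf t) x with hD
  have hwD : HasFDerivWithinAt w D (triOf t) x := hwd.differentiableWithinAt.hasFDerivWithinAt
  have hDz : ∀ z ∈ triOf t, D (z - x) =
      ‖A (x - z₀)‖ ^ 2 * L (z - x) + (L x + c) * (2 * ⟪A (x - z₀), A (z - x)⟫)
        - L' (z - x) := by
    intro z hz
    have hmem := mem_tangentConeAt_of_segment_subset ((triOf_convex t).segment_subset hx hz)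
    have := hwD.unique_on hwd hmem
    rw [this]
    simp only [ContinuousLinearMap.sub_apply, ContinuousLinearMap.add_apply,
      ContinuousLinearMap.smul_apply, ContinuousLinearMap.comp_apply, innerSL_apply_apply,
      smul_eq_mul, nsmul_eq_mul]
    norm_cast
  -- affine function vanishing up to remainder at vertices
  have hvtx : ∀ p ∈ vertsOf t, |D (p - x) + w x| ≤ 5 * M * h * Srf.rfn z₀ x := by
    intro p hp
    have hpt := verts_sub_tri t hp
    have hwp : w p = 0 := by simp only [w, hvert p hp, sub_self]
    have hpx : ‖p - x‖ ≤ h := by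
      rw [← dist_eq_norm]
      exact (Metric.dist_le_diam_of_mem (triOf_compact t).isBounded hpt hx).trans hdiam
    have hq : ‖A (p - z₀)‖ ^ 2 = ‖A (x - z₀)‖ ^ 2 + 2 * ⟪A (x - z₀), A (p - x)⟫
        + ‖A (p - x)‖ ^ 2 := by
      rw [← norm_add_sq_real, ← map_add]; congr 3; abel_nf
    have hkey : D (p - x) + w x = -(‖A (p - x)‖ ^ 2 * φ p
        + 2 * ⟪A (x - z₀), A (p - x)⟫ * (φ p - φ x)) := by
      rw [hDz p hpt]
      have e1 : w p = (‖A (x - z₀)‖ ^ 2 + 2 * ⟪A (x - z₀), A (p - x)⟫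
        + ‖A (p - x)‖ ^ 2) * φ p - v p := by simp only [w, hrfn, hq]
      have e2 : w x = ‖A (x - z₀)‖ ^ 2 * φ x - v x := by simp only [w, hrfn]
      have e3 := hφ p hpt
      have e4 := hφ x hx
      have e5 := hv p hpt
      have e6 := hv x hx
      rw [hwp] at e1
      rw [e2]
      rw [map_sub L, map_sub L']
      rw [e3, e5] at e1
      rw [e3, e4, e6]
      linear_combination -e1
    have hAp : ‖A (p - x)‖ ≤ h := (hA _).trans hpx
    have hrx := hr x hx
    rw [hkey, abs_neg]
    have i1 : |‖A (p - x)‖ ^ 2 * φ p| ≤ h * Srf.rfn z₀ x * M := by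
      rw [abs_mul, abs_of_nonneg (sq_nonneg ‖A (p - x)‖)]
      have : ‖A (p - x)‖ ^ 2 ≤ h * Srf.rfn z₀ x := by
        nlinarith [norm_nonneg (A (p - x))]
      exact mul_le_mul this (hM p hpt) (abs_nonneg _) (by nlinarith)
    have i2 : |⟪A (x - z₀), A (p - x)⟫| ≤ Srf.rfn z₀ x * h := by
      refine (abs_real_inner_le_norm _ _).trans ?_
      rw [hrfn]; gcongr
    have i3 : |φ p - φ x| ≤ 2 * M := by
      refine (abs_sub _ _).trans ?_
      linarith [hM p hpt, hM x hx]
    have i4 : |2 * ⟪A (x - z₀), A (p - x)⟫ * (φ p - φ x)| ≤ 2 * (Srf.rfn z₀ x * h) * (2 * M) := by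
      rw [abs_mul, abs_mul, abs_two]
      have : 0 ≤ Srf.rfn z₀ x := hh.le.trans hrx
      gcongr
    refine (abs_add_le _ _).trans ?_
    linarith
  have hall : ∀ z ∈ triOf t, |D (z - x) + w x| ≤ 5 * M * h * Srf.rfn z₀ x := by
    have := affine_abs_le t D.toLinearMap (w x - D x) (5 * M * h * Srf.rfn z₀ x) (by
      intro p hp
      have := hvtx p hp
      rw [map_sub] at this
      convert this using 2
      simp; ring)
    intro z hz
    have := this z hz
    rw [map_sub]
    convert this using 2
    simp; ring
  obtain ⟨y, hy, hball⟩ := hdisk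
  set g := gradTri t w x with hg
  change ‖g‖ ≤ _
  have hgdir : g ∈ dirOf t := by
    rw [hg]; unfold gradTri tGrad; exact Submodule.coe_mem _
  have hgD : D g = ‖g‖ ^ 2 := by
    have e : g = (dirOf t).starProjection ((InnerProductSpace.toDual ℝ E3).symm D) := rfl
    have e2 : D g = ⟪(InnerProductSpace.toDual ℝ E3).symm D, g⟫ := by
      rw [InnerProductSpace.toDual_symm_apply]
    have e3 := Submodule.starProjection_inner_eq_zero (K := dirOf t)
      ((InnerProductSpace.toDual ℝ E3).symm D) g hgdir
    rw [← e, inner_sub_left, real_inner_self_eq_norm_sq] at e3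
    linarith
  have hr0 : 0 < Srf.rfn z₀ x := hh.trans_le (hr x hx)
  rcases (norm_nonneg g).eq_or_lt with h0 | h0
  · rw [← h0]; positivity
  have hyp : y ∈ affineSpan ℝ (vertsOf t) := convexHull_subset_affineSpan _ hy
  have hin : ∀ s : ℝ, |s| * ‖g‖ ≤ γ₀ * h → y + s • g ∈ triOf t := by
    intro s hs
    apply hball
    refine ⟨?_, ?_⟩
    · rw [mem_closedBall, dist_eq_norm, add_sub_cancel_left, norm_smul]; exact hs
    · change y + s • g ∈ affineSpan ℝ (vertsOf t)
      have := AffineSubspace.vadd_mem_of_mem_direction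
        (Submodule.smul_mem _ s hgdir : s • g ∈ (affineSpan ℝ (vertsOf t)).direction) hyp
      rwa [vadd_eq_add, add_comm] at this
  have hs : |γ₀ * h / ‖g‖| * ‖g‖ ≤ γ₀ * h := by
    rw [abs_of_pos (by positivity)]; field_simp; rfl
  have a1 := abs_le.1 (hall _ (hin (γ₀ * h / ‖g‖) hs))
  have a2 := abs_le.1 (hall _ (hin (-(γ₀ * h / ‖g‖)) (by rwa [abs_neg])))
  simp only [map_sub, map_add, map_smul, smul_eq_mul, hgD] at a1 a2
  have e : γ₀ * h / ‖g‖ * ‖g‖ ^ 2 = γ₀ * h * ‖g‖ := by field_simp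
  have : γ₀ * h * ‖g‖ ≤ 5 * M * h * Srf.rfn z₀ x := by nlinarith [a1.2, a2.1]
  have : γ₀ * ‖g‖ ≤ 5 * M * Srf.rfn z₀ x := by
    refine le_of_mul_le_mul_left ?_ hh
    linarith
  rw [div_mul_eq_mul_div, le_div_iff₀ hγ₀]
  linarith

/-- **Superapproximation estimate.** With `Ω` the union of the triangles on which `r ≥ h`,
for every `φ ∈ V_h` and every `v ∈ V_h` interpolating `r²φ` at the vertices of those
triangles, `∫_Ω r^{-2} |∇_{S_h}(r²φ − v)|² ≤ c ∫_Ω φ²`. -/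
theorem superapproximation (Srf : SmoothSurface) (γ₀ : ℝ) (hγ₀ : 0 < γ₀) :
    ∃ c > 0, ∃ h₀ > 0,
      ∀ z₀ ∈ Srf.S,
        ∀ h : ℝ, 0 < h → h ≤ h₀ →
          ∀ Tr : Triangulation Srf γ₀ h, ∀ φ v : E3 → ℝ,
            Tr.IsVh φ → Tr.IsVh v →
            (∀ t ∈ Tr.T, (∀ x ∈ triOf t, h ≤ Srf.rfn z₀ x) →
              ∀ vtx ∈ vertsOf t, v vtx = Srf.rfn z₀ vtx ^ 2 * φ vtx) →
            (∑ t ∈ Tr.T, ∫ x in triOf t ∩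
                  (⋃ t' ∈ Tr.T, ⋃ (_ : ∀ x' ∈ triOf t', h ≤ Srf.rfn z₀ x'), triOf t'),
                (Srf.rfn z₀ x ^ 2)⁻¹ *
                  ‖gradTri t (fun y => Srf.rfn z₀ y ^ 2 * φ y - v y) x‖ ^ 2 ∂μH[2]) ≤
              c * ∑ t ∈ Tr.T, ∫ x in triOf t ∩
                  (⋃ t' ∈ Tr.T, ⋃ (_ : ∀ x' ∈ triOf t', h ≤ Srf.rfn z₀ x'), triOf t'),
                φ x ^ 2 ∂μH[2] := by
  refine ⟨1600 / γ₀ ^ 2, by positivity, 1, one_pos, ?_⟩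
  intro z₀ _ h hh _ Tr φ v hφ hv hintg
  rw [Finset.mul_sum]
  refine Finset.sum_le_sum fun t ht => ?_
  set Ω : Set E3 := ⋃ t' ∈ Tr.T, ⋃ (_ : ∀ x' ∈ triOf t', h ≤ Srf.rfn z₀ x'), triOf t' with hΩ
  by_cases hgood : ∀ x' ∈ triOf t, h ≤ Srf.rfn z₀ x'
  · have hsub : triOf t ⊆ Ω := by
      intro x hx
      simp only [hΩ, Set.mem_iUnion]
      exact ⟨t, ht, hgood, hx⟩
    rw [Set.inter_eq_left.2 hsub]
    obtain ⟨L, c, hL⟩ := hφ.2 t ht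
    obtain ⟨L', c', hL'⟩ := hv.2 t ht
    obtain ⟨p, hp, hmaxv⟩ := exists_max_vertex t (fun x => |φ x|)
    have hmax : ∀ x ∈ triOf t, |φ x| ≤ |φ p| := by
      intro x hx
      rw [hL x hx]
      refine affine_abs_le t L c _ (fun q hq => ?_) x hx
      rw [← hL q (verts_sub_tri t hq)]
      exact hmaxv q hq
    have hmass := mass_lower t φ L c hL p hp hmax
    have hb := norm_setIntegral_le_of_norm_le_const (μ := (μH[2] : Measure E3))
      (f := fun x => (Srf.rfn z₀ x ^ 2)⁻¹ *
        ‖gradTri t (fun y => Srf.rfn z₀ y ^ 2 * φ y - v y) x‖ ^ 2)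
      (C := 25 / γ₀ ^ 2 * |φ p| ^ 2) (tri_measure_lt_top t) (by
        intro x hx
        have hg := grad_bound Srf hγ₀ hh z₀ t (Tr.diam_le t ht) (Tr.disk t ht) φ v L c hL L' c' hL'
          hgood (hintg t ht hgood) _ hmax x hx
        have hr0 : 0 < Srf.rfn z₀ x := hh.trans_le (hgood x hx)
        rw [Real.norm_of_nonneg (by positivity)]
        rw [inv_mul_le_iff₀ (by positivity)]
        refine (pow_le_pow_left₀ (norm_nonneg _) hg 2).trans (le_of_eq ?_)
        ring)
    refine (le_abs_self _).trans (hb.trans ?_)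
    have h2 := mul_le_mul_of_nonneg_left hmass (show 0 ≤ 25 / γ₀ ^ 2 by positivity)
    calc _ = 25 / γ₀ ^ 2 * (|φ p| ^ 2 * (μH[2] : Measure E3).real (triOf t)) := by ring
      _ ≤ _ := h2
      _ = _ := by ring
  · have hnull : (μH[2] : Measure E3) (triOf t ∩ Ω) = 0 := by
      have hsub : triOf t ∩ Ω ⊆ ⋃ t' ∈ Tr.T.erase t, triOf t ∩ triOf t' := by
        rintro x ⟨hx, hxΩ⟩
        simp only [hΩ, Set.mem_iUnion] at hxΩ
        obtain ⟨t', ht', hg', hx'⟩ := hxΩ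
        simp only [Set.mem_iUnion]
        refine ⟨t', Finset.mem_erase.2 ⟨?_, ht'⟩, hx, hx'⟩
        rintro rfl
        exact hgood hg'
      refine measure_mono_null hsub ?_
      refine (measure_biUnion_null_iff (Finset.countable_toSet (Tr.T.erase t))).2 ?_
      intro t' ht'
      rw [Finset.mem_coe, Finset.mem_erase] at ht'
      rcases Tr.meet t ht t' ht'.2 (Ne.symm ht'.1) with h | ⟨a, _, h⟩ | ⟨a, b, _, _, _, h⟩
      · rw [h]; simp
      · rw [h, ← segment_same ℝ a]; exact segment_null a a
      · rw [h]; exact segment_null a b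
    rw [setIntegral_measure_zero _ hnull, setIntegral_measure_zero _ hnull, mul_zero]

end
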